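/- arXiv:2310.12712 — 2 statements merged into one kernel-verified Lean document; each statement's English description precedes it below -/
import Mathlib

section
/- Let d ≥ 1, let H ∈ ℝ^{d×d} be symmetric with tr(H) > 0 and eigendecomposition H = R D Rᵀ, where R is orthogonal and D is diagonal with increasing diagonal entries D₁ ≤ … ≤ D_d, and let σ, h > 0. Let λ* be a minimizer of the reduced objective g over the feasible set Λ, let k be an index with λ*_k = maxᵢ λ*ᵢ, let Σ* be the diagonal matrix with Σ*ᵢᵢ = √(λ*ᵢ), and suppose V* ∈ ℝ^{d×d} is an orthogonal matrix satisfying (V*ᵢⱼ)² = 1/d for all i, j and whose k-th column equals (1/√d)·𝟙 (such a Hadamard-type matrix exists whenever d is a power of two). Then S* = R Σ* (V*)ᵀ is invertible, satisfies ‖S*‖₂ ≤ h, and for every invertible S ∈ ℝ^{d×d} with ‖S‖₂ ≤ h one has AE_H(S*) + NE(S*) ≤ AE_H(S) + NE(S). -/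
open Matrix

/-- The approximation error `AE_H(S) = (1/4)‖S⁻ᵀ [s₁ᵀHs₁, …, s_dᵀHs_d]ᵀ‖₂²`,
where `sᵢ` are the columns of `S`. -/
noncomputable def approxErr {n : Type*} [Fintype n] [DecidableEq n]
    (H S : Matrix n n ℝ) : ℝ :=
  (1 / 4) * ∑ i, ((Sᵀ)⁻¹.mulVec (fun j => (fun k => S k j) ⬝ᵥ H.mulVec (fun k => S k j)) i) ^ 2

/-- The noise error `NE(S) = σ²‖S⁻¹‖_F² + σ²‖S⁻ᵀ𝟙‖₂²`. -/
noncomputable def noiseErr {n : Type*} [Fintype n] [DecidableEq n]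
    (σ : ℝ) (S : Matrix n n ℝ) : ℝ :=
  σ ^ 2 * ∑ i, ∑ j, (S⁻¹ i j) ^ 2 + σ ^ 2 * ∑ i, ((Sᵀ)⁻¹.mulVec (fun _ => 1) i) ^ 2

/-- The ℓ²-operator norm of a square real matrix. -/
noncomputable def opNorm {d : ℕ} (M : Matrix (Fin d) (Fin d) ℝ) : ℝ :=
  ‖Matrix.toEuclideanCLM (𝕜 := ℝ) M‖

/-- The reduced objective
`g(λ) = (Σᵢ Dᵢλᵢ)²/(4d·λ_max) + σ²Σᵢ 1/λᵢ + σ²d/λ_max`. -/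
noncomputable def gObj {d : ℕ} (Dv : Fin d → ℝ) (σ : ℝ) (lam : Fin d → ℝ) : ℝ :=
  (∑ i, Dv i * lam i) ^ 2 / (4 * d * (⨆ i, lam i))
    + σ ^ 2 * ∑ i, 1 / lam i + σ ^ 2 * d / (⨆ i, lam i)

section OrthogonalMatrices

variable {n : Type*} [Fintype n]

/-- If `∑ aᵢ > 0`, then raising the coordinates of `μ` towards its largest entry can bring a
negative value of `∑ aᵢ μᵢ` to zero. -/
lemma exists_le_sq_sum_mul_le {a μ : n → ℝ} {T M : ℝ} (ha : 0 < ∑ i, a i) (hM : 0 < M)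
    (hμM : ∀ i, μ i ≤ M) (hT : ∑ i, a i * μ i ≤ T) :
    ∃ ν : n → ℝ, (∀ i, μ i ≤ ν i) ∧ (∀ i, ν i ≤ M) ∧ (∑ i, a i * ν i) ^ 2 ≤ T ^ 2 := by
  by_cases h0 : 0 ≤ ∑ i, a i * μ i
  · exact ⟨μ, fun _ => le_rfl, hμM, pow_le_pow_left₀ h0 hT 2⟩
  push Not at h0
  set T₀ := ∑ i, a i * μ i with hT₀
  set T₁ := M * ∑ i, a i with hT₁
  have hT₁pos : 0 < T₁ := mul_pos hM ha
  have hden : 0 < T₁ - T₀ := by linarith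
  set t := -T₀ / (T₁ - T₀) with ht
  have ht0 : 0 ≤ t := div_nonneg (by linarith) hden.le
  have ht1 : t ≤ 1 := (div_le_one hden).mpr (by linarith)
  refine ⟨fun i => μ i + t * (M - μ i), fun i => ?_, fun i => ?_, ?_⟩
  · nlinarith [mul_nonneg ht0 (sub_nonneg.mpr (hμM i))]
  · nlinarith [mul_nonneg (sub_nonneg.mpr ht1) (sub_nonneg.mpr (hμM i))]
  · have hsum : ∑ i, a i * (μ i + t * (M - μ i)) = T₀ + t * (T₁ - T₀) := by
      rw [hT₀, hT₁, Finset.mul_sum, ← Finset.sum_sub_distrib, Finset.mul_sum,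
        ← Finset.sum_add_distrib]
      exact Finset.sum_congr rfl fun i _ => by ring
    have hzero : T₀ + t * (T₁ - T₀) = 0 := by
      rw [ht, div_mul_cancel₀ _ hden.ne']; ring
    rw [hsum, hzero, zero_pow two_ne_zero]
    exact sq_nonneg T

/-- The quadratic forms of `H` at the columns of `S` are the diagonal entries of `Sᵀ H S`. -/
lemma col_dotProduct_mulVec_col (H S : Matrix n n ℝ) (j : n) :
    (fun k => S k j) ⬝ᵥ H *ᵥ (fun k => S k j) = (Sᵀ * H * S) j j := by
  rw [Matrix.mul_assoc]
  simp only [mul_apply, dotProduct, mulVec, transpose_apply]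

variable [DecidableEq n]

lemma dotProduct_mulVec_self_of_orthogonal {Q : Matrix n n ℝ} (hQ : Qᵀ * Q = 1) (x : n → ℝ) :
    (Q *ᵥ x) ⬝ᵥ (Q *ᵥ x) = x ⬝ᵥ x := by
  rw [dotProduct_mulVec, ← mulVec_transpose, mulVec_mulVec, hQ, one_mulVec]

lemma mul_diagonal_mul_transpose_apply_self (V : Matrix n n ℝ) (w : n → ℝ) (j : n) :
    (V * diagonal w * Vᵀ) j j = ∑ i, V j i ^ 2 * w i := by
  rw [mul_apply]
  refine Finset.sum_congr rfl fun i _ => ?_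
  rw [mul_diagonal, transpose_apply]
  ring

/-- The squared Frobenius norm of `S⁻¹` is the sum of the inverse eigenvalues of `S Sᵀ`. -/
lemma sum_sq_inv_eq_sum_one_div {S U : Matrix n n ℝ} {μ : n → ℝ} (hU : Uᵀ * U = 1)
    (hμ : ∀ i, 0 < μ i) (hS : S * Sᵀ = U * diagonal μ * Uᵀ) :
    ∑ i, ∑ j, (S⁻¹ i j) ^ 2 = ∑ i, 1 / μ i := by
  have hU' : U * Uᵀ = 1 := mul_eq_one_comm.mp hU
  have hdiag : diagonal μ * diagonal (fun i => 1 / μ i) = 1 := by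
    rw [diagonal_mul_diagonal, ← diagonal_one]
    congr 1
    ext i
    exact mul_one_div_cancel (hμ i).ne'
  have hinv : (S * Sᵀ)⁻¹ = U * diagonal (fun i => 1 / μ i) * Uᵀ := by
    refine inv_eq_right_inv ?_
    calc S * Sᵀ * (U * diagonal (fun i => 1 / μ i) * Uᵀ)
        = U * diagonal μ * (Uᵀ * U) * diagonal (fun i => 1 / μ i) * Uᵀ := by
          rw [hS]; simp only [Matrix.mul_assoc]
      _ = 1 := by rw [hU, Matrix.mul_one, Matrix.mul_assoc U, hdiag, Matrix.mul_one, hU']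
  calc ∑ i, ∑ j, (S⁻¹ i j) ^ 2 = ((S⁻¹)ᵀ * S⁻¹).trace := by
        rw [Finset.sum_comm]
        simp only [trace, diag_apply, mul_apply, transpose_apply, sq]
    _ = ((S * Sᵀ)⁻¹).trace := by rw [Matrix.mul_inv_rev, transpose_nonsing_inv]
    _ = ∑ i, 1 / μ i := by
        rw [hinv, trace_mul_comm, ← Matrix.mul_assoc, hU, Matrix.one_mul, trace_diagonal]

/-- Spectral decomposition of `S Sᵀ` for invertible `S`. -/
lemma exists_orthogonal_diagonalization_mul_transpose {S : Matrix n n ℝ} (hS : IsUnit S.det) :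
    ∃ (U : Matrix n n ℝ) (μ : n → ℝ), Uᵀ * U = 1 ∧ (∀ i, 0 < μ i) ∧
      S * Sᵀ = U * diagonal μ * Uᵀ := by
  have hpos : (S * Sᵀ).PosDef := by
    have := PosDef.mul_conjTranspose_self S (vecMul_injective_of_isUnit
      ((isUnit_iff_isUnit_det S).mpr hS))
    rwa [conjTranspose_eq_transpose_of_trivial] at this
  have hH := hpos.isHermitian
  refine ⟨hH.eigenvectorUnitary, hH.eigenvalues, ?_, hpos.eigenvalues_pos, ?_⟩
  · have := Unitary.coe_star_mul_self hH.eigenvectorUnitary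
    rwa [star_eq_conjTranspose, conjTranspose_eq_transpose_of_trivial] at this
  · have := hH.spectral_theorem
    rw [Unitary.conjStarAlgAut_apply, star_eq_conjTranspose,
      conjTranspose_eq_transpose_of_trivial] at this
    exact this

lemma sq_apply_mem_doublyStochastic {W : Matrix n n ℝ} (hW : Wᵀ * W = 1) :
    (of fun i j => W i j ^ 2) ∈ doublyStochastic ℝ n := by
  have hW' : W * Wᵀ = 1 := mul_eq_one_comm.mp hW
  refine mem_doublyStochastic_iff_sum.mpr ⟨fun i j => sq_nonneg _, fun i => ?_, fun j => ?_⟩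
  · simpa [mul_apply, sq] using congr_fun₂ hW' i i
  · simpa [mul_apply, sq] using congr_fun₂ hW j j

/-- A bilinear form in two vectors, weighted by a doubly stochastic matrix, is at least its value
at some pairing of the coordinates. -/
lemma exists_perm_sum_mul_le {Q : Matrix n n ℝ} (hQ : Q ∈ doublyStochastic ℝ n) (a μ : n → ℝ) :
    ∃ π : Equiv.Perm n, ∑ i, a i * μ (π i) ≤ ∑ i, ∑ j, a i * Q i j * μ j := by
  obtain ⟨w, hw0, hw1, hwQ⟩ := exists_eq_sum_perm_of_mem_doublyStochastic hQ
  have hexp : ∑ i, ∑ j, a i * Q i j * μ j = ∑ π, w π * ∑ i, a i * μ (π i) := by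
    have h1 : ∀ i, ∑ j, a i * Q i j * μ j = a i * (Q *ᵥ μ) i := fun i => by
      simp only [mulVec, dotProduct, Finset.mul_sum, mul_assoc]
    simp_rw [h1, ← hwQ, sum_mulVec, Finset.sum_apply, smul_mulVec, Pi.smul_apply,
      Equiv.Perm.permMatrix, PEquiv.toMatrix_toPEquiv_mulVec, Function.comp_apply, smul_eq_mul,
      Finset.mul_sum]
    rw [Finset.sum_comm]
    exact Finset.sum_congr rfl fun π _ => Finset.sum_congr rfl fun i _ => by ring
  by_contra! hlt
  have hw : ∑ π, w π * (∑ i, ∑ j, a i * Q i j * μ j) < ∑ π, w π * ∑ i, a i * μ (π i) := by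
    obtain ⟨π, -, hπ⟩ := Finset.exists_lt_of_sum_lt (s := Finset.univ)
      (f := fun _ : Equiv.Perm n => (0 : ℝ)) (g := w) (by simp [hw1])
    exact Finset.sum_lt_sum (fun π _ => mul_le_mul_of_nonneg_left (hlt π).le (hw0 π))
      ⟨π, Finset.mem_univ _, mul_lt_mul_of_pos_left (hlt π) hπ⟩
  rw [← Finset.sum_mul, hw1, one_mul, ← hexp] at hw
  exact lt_irrefl _ hw

lemma dotProduct_le_mul_dotProduct_inv_transpose_mulVec {S U : Matrix n n ℝ} {μ : n → ℝ} {M : ℝ}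
    (hS : IsUnit S.det) (hU : Uᵀ * U = 1) (hSU : S * Sᵀ = U * diagonal μ * Uᵀ)
    (hμM : ∀ i, μ i ≤ M) (v : n → ℝ) :
    v ⬝ᵥ v ≤ M * (((Sᵀ)⁻¹ *ᵥ v) ⬝ᵥ ((Sᵀ)⁻¹ *ᵥ v)) := by
  set w := (Sᵀ)⁻¹ *ᵥ v with hw
  have hv : v = Sᵀ *ᵥ w := by
    rw [hw, mulVec_mulVec, mul_nonsing_inv _ (by rwa [det_transpose]), one_mulVec]
  have hU' : (Uᵀ)ᵀ * Uᵀ = 1 := by rw [transpose_transpose]; exact mul_eq_one_comm.mp hU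
  calc v ⬝ᵥ v = w ⬝ᵥ (S * Sᵀ) *ᵥ w := by
        rw [hv, ← mulVec_mulVec, dotProduct_mulVec w, ← mulVec_transpose]
    _ = (Uᵀ *ᵥ w) ⬝ᵥ diagonal μ *ᵥ (Uᵀ *ᵥ w) := by
        rw [hSU, ← mulVec_mulVec, ← mulVec_mulVec, dotProduct_mulVec, ← mulVec_transpose]
    _ ≤ M * ((Uᵀ *ᵥ w) ⬝ᵥ (Uᵀ *ᵥ w)) := by
        simp only [dotProduct, mulVec_diagonal, Finset.mul_sum]
        exact Finset.sum_le_sum fun i _ => by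
          nlinarith [mul_le_mul_of_nonneg_right (hμM i) (mul_self_nonneg ((Uᵀ *ᵥ w) i))]
    _ = M * (w ⬝ᵥ w) := by rw [dotProduct_mulVec_self_of_orthogonal hU']

end OrthogonalMatrices

lemma opNorm_le_iff {d : ℕ} {h : ℝ} (hh : 0 ≤ h) (M : Matrix (Fin d) (Fin d) ℝ) :
    opNorm M ≤ h ↔ ∀ x : Fin d → ℝ, (M *ᵥ x) ⬝ᵥ (M *ᵥ x) ≤ h ^ 2 * (x ⬝ᵥ x) := by
  have hnorm : ∀ x : EuclideanSpace ℝ (Fin d), ‖x‖ ^ 2 = x.ofLp ⬝ᵥ x.ofLp := fun x => by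
    rw [EuclideanSpace.real_norm_sq_eq]
    simp only [dotProduct, sq]
  rw [opNorm, ContinuousLinearMap.opNorm_le_iff hh]
  have key : ∀ x : EuclideanSpace ℝ (Fin d), ‖toEuclideanCLM (𝕜 := ℝ) M x‖ ≤ h * ‖x‖ ↔
      (M *ᵥ x.ofLp) ⬝ᵥ (M *ᵥ x.ofLp) ≤ h ^ 2 * (x.ofLp ⬝ᵥ x.ofLp) := fun x => by
    rw [← sq_le_sq₀ (norm_nonneg _) (by positivity), mul_pow, hnorm, hnorm, ofLp_toEuclideanCLM]
  simp_rw [key]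
  exact ⟨fun H x => H (WithLp.toLp 2 x), fun H x => H x.ofLp⟩

/-- The eigenvalues of `S Sᵀ` are bounded by the square of the operator norm of `S`. -/
lemma eigenvalue_mul_transpose_le_sq {d : ℕ} {h : ℝ} (hh : 0 ≤ h)
    {S U : Matrix (Fin d) (Fin d) ℝ} {μ : Fin d → ℝ} (hU : Uᵀ * U = 1) (hμ : ∀ i, 0 < μ i)
    (hSU : S * Sᵀ = U * diagonal μ * Uᵀ) (hS : opNorm S ≤ h) (i : Fin d) : μ i ≤ h ^ 2 := by
  set u : Fin d → ℝ := U *ᵥ Pi.single i 1 with hu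
  have huu : u ⬝ᵥ u = 1 := by
    rw [hu, dotProduct_mulVec_self_of_orthogonal hU]; simp
  have hAu : S *ᵥ (Sᵀ *ᵥ u) = μ i • u := by
    rw [mulVec_mulVec, hSU, hu, mulVec_mulVec, Matrix.mul_assoc, hU, Matrix.mul_one,
      ← mulVec_mulVec, ← mulVec_smul]
    congr 1
    ext j
    rw [mulVec_diagonal]
    by_cases hj : j = i
    · subst hj; simp
    · simp [hj]
  have hq : (Sᵀ *ᵥ u) ⬝ᵥ (Sᵀ *ᵥ u) = μ i := by
    rw [dotProduct_mulVec, ← mulVec_transpose, transpose_transpose, hAu, smul_dotProduct, huu,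
      smul_eq_mul, mul_one]
  have := (opNorm_le_iff hh S).mp hS (Sᵀ *ᵥ u)
  rw [hAu, hq, smul_dotProduct, dotProduct_smul, huu, smul_eq_mul, smul_eq_mul, mul_one] at this
  exact le_of_mul_le_mul_right this (hμ i)

lemma opNorm_mul_diagonal_mul_transpose_le {d : ℕ} {h : ℝ} (hh : 0 ≤ h)
    {R V : Matrix (Fin d) (Fin d) ℝ} {s : Fin d → ℝ} (hR : Rᵀ * R = 1) (hV : Vᵀ * V = 1)
    (hs : ∀ i, s i ^ 2 ≤ h ^ 2) : opNorm (R * diagonal s * Vᵀ) ≤ h := by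
  have hV' : (Vᵀ)ᵀ * Vᵀ = 1 := by rw [transpose_transpose]; exact mul_eq_one_comm.mp hV
  refine (opNorm_le_iff hh _).mpr fun x => ?_
  rw [← mulVec_mulVec, ← mulVec_mulVec, dotProduct_mulVec_self_of_orthogonal hR,
    ← dotProduct_mulVec_self_of_orthogonal hV' x]
  simp only [dotProduct, mulVec_diagonal, Finset.mul_sum]
  exact Finset.sum_le_sum fun i _ => by
    nlinarith [mul_le_mul_of_nonneg_right (hs i) (mul_self_nonneg ((Vᵀ *ᵥ x) i))]

lemma gObj_eq_of_isMax {d : ℕ} (a : Fin d → ℝ) (σ : ℝ) {ν : Fin d → ℝ} {M : ℝ} {k : Fin d}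
    (hk : ν k = M) (hν : ∀ i, ν i ≤ M) :
    gObj a σ ν = (∑ i, a i * ν i) ^ 2 / (4 * d * M) + σ ^ 2 * ∑ i, 1 / ν i + σ ^ 2 * d / M := by
  have : Nonempty (Fin d) := ⟨k⟩
  have hsup : ⨆ i, ν i = M :=
    le_antisymm (ciSup_le hν) (hk ▸ le_ciSup (Set.finite_range ν).bddAbove k)
  rw [gObj, hsup]

/-- On the equal-weight design `R Σ Vᵀ` the two errors add up to the reduced objective. -/
lemma approxErr_add_noiseErr_eq_gObj {d : ℕ} (σ : ℝ) {R V : Matrix (Fin d) (Fin d) ℝ}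
    {Dv lam : Fin d → ℝ} (hR : Rᵀ * R = 1) (hlam : ∀ i, 0 < lam i) {k : Fin d}
    (hk : lam k = ⨆ i, lam i) (hV : Vᵀ * V = 1) (hVsq : ∀ i j, V i j ^ 2 = 1 / d)
    (hVk : ∀ i, V i k = 1 / Real.sqrt d) :
    approxErr (R * diagonal Dv * Rᵀ) (R * diagonal (fun i => Real.sqrt (lam i)) * Vᵀ)
      + noiseErr σ (R * diagonal (fun i => Real.sqrt (lam i)) * Vᵀ) = gObj Dv σ lam := by
  have hd : (0 : ℝ) < d := by exact_mod_cast k.pos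
  have hV' : V * Vᵀ = 1 := mul_eq_one_comm.mp hV
  have hR' : R * Rᵀ = 1 := mul_eq_one_comm.mp hR
  set s : Fin d → ℝ := fun i => Real.sqrt (lam i) with hs
  have hspos : ∀ i, 0 < s i := fun i => Real.sqrt_pos.mpr (hlam i)
  have hssq : ∀ i, s i * s i = lam i := fun i => Real.mul_self_sqrt (hlam i).le
  have hST : (R * diagonal s * Vᵀ)ᵀ = V * diagonal s * Rᵀ := by
    simp [transpose_mul, Matrix.mul_assoc]
  have hSS : R * diagonal s * Vᵀ * (R * diagonal s * Vᵀ)ᵀ = R * diagonal lam * Rᵀ := by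
    calc _ = R * diagonal s * (Vᵀ * V) * diagonal s * Rᵀ := by
          rw [hST]; simp only [Matrix.mul_assoc]
      _ = R * (diagonal s * diagonal s) * Rᵀ := by
          rw [hV, Matrix.mul_one]; simp only [Matrix.mul_assoc]
      _ = _ := by simp only [diagonal_mul_diagonal, hssq]
  have hinv : ((R * diagonal s * Vᵀ)ᵀ)⁻¹ = R * diagonal (fun i => 1 / s i) * Vᵀ := by
    refine inv_eq_right_inv ?_
    calc _ = V * diagonal s * (Rᵀ * R) * diagonal (fun i => 1 / s i) * Vᵀ := by
          rw [hST]; simp only [Matrix.mul_assoc]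
      _ = V * (diagonal s * diagonal (fun i => 1 / s i)) * Vᵀ := by
          rw [hR, Matrix.mul_one]; simp only [Matrix.mul_assoc]
      _ = 1 := by
          simp only [diagonal_mul_diagonal, mul_one_div_cancel (hspos _).ne', diagonal_one,
            Matrix.mul_one, hV']
  have hVone : ∀ i, (Vᵀ *ᵥ fun _ => (1 : ℝ)) i = if i = k then Real.sqrt d else 0 := fun i => by
    have h1 : ∑ j, V j i * V j k = if i = k then 1 else 0 := by
      simpa [mul_apply, one_apply] using congr_fun₂ hV i k
    simp only [hVk, ← Finset.sum_mul] at h1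
    have hsd : Real.sqrt d ≠ 0 := (Real.sqrt_pos.mpr hd).ne'
    simp only [mulVec, dotProduct, transpose_apply, mul_one]
    calc ∑ j, V j i = (∑ j, V j i) * (1 / Real.sqrt d) * Real.sqrt d := by field_simp
      _ = _ := by rw [h1]; split_ifs <;> simp
  have hone : ∀ c : ℝ, ∑ i, (((R * diagonal s * Vᵀ)ᵀ)⁻¹ *ᵥ fun _ => c) i ^ 2
      = c ^ 2 * (d / lam k) := fun c => by
    have hc : (fun _ : Fin d => c) = c • fun _ => (1 : ℝ) := by ext; simp
    calc _ = (((R * diagonal s * Vᵀ)ᵀ)⁻¹ *ᵥ fun _ => c) ⬝ᵥ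
          (((R * diagonal s * Vᵀ)ᵀ)⁻¹ *ᵥ fun _ => c) := by simp only [dotProduct, sq]
      _ = c ^ 2 * ∑ i, if i = k then d / lam k else 0 := by
          rw [hinv, ← mulVec_mulVec, ← mulVec_mulVec, dotProduct_mulVec_self_of_orthogonal hR, hc,
            mulVec_smul, mulVec_smul, smul_dotProduct, dotProduct_smul, smul_eq_mul, smul_eq_mul,
            ← mul_assoc, ← sq]
          congr 1
          refine Finset.sum_congr rfl fun i _ => ?_
          rw [mulVec_diagonal, hVone]
          split_ifs with hi
          · subst hi
            rw [← hssq i]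
            nth_rewrite 3 [← Real.mul_self_sqrt hd.le]
            have := (hspos i).ne'
            field_simp
          · simp
      _ = _ := by simp
  have hquad : ∀ j, (fun l => (R * diagonal s * Vᵀ) l j) ⬝ᵥ
      (R * diagonal Dv * Rᵀ) *ᵥ (fun l => (R * diagonal s * Vᵀ) l j)
      = (∑ i, Dv i * lam i) / d := fun j => by
    rw [col_dotProduct_mulVec_col]
    have : (R * diagonal s * Vᵀ)ᵀ * (R * diagonal Dv * Rᵀ) * (R * diagonal s * Vᵀ)
        = V * diagonal (fun i => Dv i * lam i) * Vᵀ := by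
      calc _ = V * diagonal s * (Rᵀ * R) * diagonal Dv * (Rᵀ * R) * diagonal s * Vᵀ := by
            rw [hST]; simp only [Matrix.mul_assoc]
        _ = V * (diagonal s * diagonal Dv * diagonal s) * Vᵀ := by
            rw [hR, Matrix.mul_one, Matrix.mul_one]; simp only [Matrix.mul_assoc]
        _ = _ := by
            simp only [diagonal_mul_diagonal, ← hssq]
            congr 3
            ext i
            ring
    rw [this, mul_diagonal_mul_transpose_apply_self, Finset.sum_div]
    exact Finset.sum_congr rfl fun i _ => by rw [hVsq]; ring
  have hle : ∀ i, lam i ≤ lam k := fun i => by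
    rw [hk]; exact le_ciSup (Set.finite_range lam).bddAbove i
  rw [gObj_eq_of_isMax Dv σ rfl hle, approxErr, noiseErr, sum_sq_inv_eq_sum_one_div hR hlam hSS]
  simp only [hquad]
  rw [hone, hone]
  have := (hlam k).ne'
  field_simp
  ring

/-- Every admissible design is dominated by a feasible point of the reduced problem. -/
lemma exists_gObj_le_approxErr_add_noiseErr {d : ℕ} (hd : 1 ≤ d) {σ h : ℝ} (hh : 0 ≤ h)
    {R : Matrix (Fin d) (Fin d) ℝ} {Dv : Fin d → ℝ} (hR : Rᵀ * R = 1) (hDv : 0 < ∑ i, Dv i)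
    {S : Matrix (Fin d) (Fin d) ℝ} (hS : IsUnit S.det) (hSh : opNorm S ≤ h) :
    ∃ ν : Fin d → ℝ, (∀ i, 0 < ν i ∧ ν i ≤ h ^ 2) ∧
      gObj Dv σ ν ≤ approxErr (R * diagonal Dv * Rᵀ) S + noiseErr σ S := by
  have : Nonempty (Fin d) := ⟨⟨0, hd⟩⟩
  have hd0 : (0 : ℝ) < d := by exact_mod_cast hd
  obtain ⟨U, μ, hU, hμ, hSU⟩ := exists_orthogonal_diagonalization_mul_transpose hS
  obtain ⟨m, hm⟩ := Finite.exists_max μ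
  have hM : 0 < μ m := hμ m
  set v : Fin d → ℝ := fun j => (fun l => S l j) ⬝ᵥ (R * diagonal Dv * Rᵀ) *ᵥ fun l => S l j
    with hv
  have hW : (Rᵀ * U)ᵀ * (Rᵀ * U) = 1 := by
    calc _ = Uᵀ * (R * Rᵀ) * U := by
          rw [transpose_mul, transpose_transpose]; simp only [Matrix.mul_assoc]
      _ = 1 := by rw [mul_eq_one_comm.mp hR, Matrix.mul_one, hU]
  have hsumv : ∑ j, v j = ∑ i, ∑ j, Dv i * (of fun i j => (Rᵀ * U) i j ^ 2) i j * μ j := by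
    calc ∑ j, v j = (Sᵀ * (R * diagonal Dv * Rᵀ) * S).trace := by
          simp only [hv, col_dotProduct_mulVec_col, trace, diag_apply]
      _ = (R * diagonal Dv * Rᵀ * (S * Sᵀ)).trace := by
          rw [Matrix.mul_assoc, trace_mul_comm, Matrix.mul_assoc _ S]
      _ = (diagonal Dv * ((Rᵀ * U) * diagonal μ * (Rᵀ * U)ᵀ)).trace := by
          rw [hSU, transpose_mul, transpose_transpose, Matrix.mul_assoc R, Matrix.mul_assoc R,
            trace_mul_comm]
          simp only [Matrix.mul_assoc]
      _ = _ := by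
          simp only [trace, diag_apply, diagonal_mul, mul_diagonal_mul_transpose_apply_self,
            Finset.mul_sum, of_apply]
          exact Finset.sum_congr rfl fun i _ => Finset.sum_congr rfl fun j _ => by ring
  obtain ⟨π, hπ⟩ := exists_perm_sum_mul_le (sq_apply_mem_doublyStochastic hW) Dv μ
  rw [← hsumv] at hπ
  obtain ⟨ν, hμν, hνM, hνsq⟩ := exists_le_sq_sum_mul_le hDv hM (fun i => hm (π i)) hπ
  have hνpos : ∀ i, 0 < ν i := fun i => (hμ _).trans_le (hμν i)
  have hνmax : ν (π.symm m) = μ m :=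
    le_antisymm (hνM _) (by simpa using hμν (π.symm m))
  refine ⟨ν, fun i => ⟨hνpos i, (hνM i).trans
    (eigenvalue_mul_transpose_le_sq hh hU hμ hSU hSh m)⟩, ?_⟩
  have hbound := dotProduct_le_mul_dotProduct_inv_transpose_mulVec hS hU hSU hm
  have hinv : ∑ i, 1 / ν i ≤ ∑ i, 1 / μ i := by
    rw [← Equiv.sum_comp π fun i => 1 / μ i]
    exact Finset.sum_le_sum fun i _ => one_div_le_one_div_of_le (hμ _) (hμν i)
  have hcs : (∑ j, v j) ^ 2 ≤ d * (v ⬝ᵥ v) := by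
    simpa [dotProduct, sq] using sq_sum_le_card_mul_sum_sq (s := Finset.univ) (f := v)
  have happrox : (∑ i, Dv i * ν i) ^ 2 / (4 * d * μ m)
      ≤ 1 / 4 * (((Sᵀ)⁻¹ *ᵥ v) ⬝ᵥ ((Sᵀ)⁻¹ *ᵥ v)) := by
    rw [div_le_iff₀ (by positivity)]
    nlinarith [mul_le_mul_of_nonneg_left (hbound v) hd0.le]
  have hones : d / μ m ≤ ((Sᵀ)⁻¹ *ᵥ fun _ => 1) ⬝ᵥ ((Sᵀ)⁻¹ *ᵥ fun _ => 1) := by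
    rw [div_le_iff₀ hM, mul_comm]
    simpa [dotProduct] using hbound fun _ => 1
  rw [gObj_eq_of_isMax Dv σ hνmax hνM, approxErr, noiseErr, sum_sq_inv_eq_sum_one_div hU hμ hSU,
    mul_div_assoc]
  simp only [dotProduct, ← sq] at happrox hones
  have h1 := mul_le_mul_of_nonneg_left hinv (sq_nonneg σ)
  have h2 := mul_le_mul_of_nonneg_left hones (sq_nonneg σ)
  linarith

/-- Optimality of the CASG sample set `S* = R Σ* (V*)ᵀ`. -/
theorem casg_optimal_sample_set
    (d : ℕ) (hd : 1 ≤ d) (σ h : ℝ) (hσ : 0 < σ) (hh : 0 < h)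
    (H R D : Matrix (Fin d) (Fin d) ℝ)
    (hH : H.IsSymm) (htr : 0 < H.trace)
    (hR : Rᵀ * R = 1) (hHRD : H = R * D * Rᵀ) (hDdiag : D.IsDiag)
    (hDmono : ∀ i j : Fin d, i ≤ j → D i i ≤ D j j)
    (lam : Fin d → ℝ)
    (hlamFeas : ∀ i, 0 < lam i ∧ lam i ≤ h ^ 2)
    (hlamMin : ∀ mu : Fin d → ℝ, (∀ i, 0 < mu i ∧ mu i ≤ h ^ 2) →
      gObj (fun i => D i i) σ lam ≤ gObj (fun i => D i i) σ mu)
    (k : Fin d) (hk : lam k = ⨆ i, lam i)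
    (V : Matrix (Fin d) (Fin d) ℝ) (hV : Vᵀ * V = 1)
    (hVsq : ∀ i j, (V i j) ^ 2 = 1 / d)
    (hVk : ∀ i, V i k = 1 / Real.sqrt d) :
    IsUnit (R * Matrix.diagonal (fun i => Real.sqrt (lam i)) * Vᵀ).det ∧
    opNorm (R * Matrix.diagonal (fun i => Real.sqrt (lam i)) * Vᵀ) ≤ h ∧
    ∀ S : Matrix (Fin d) (Fin d) ℝ, IsUnit S.det → opNorm S ≤ h →
      approxErr H (R * Matrix.diagonal (fun i => Real.sqrt (lam i)) * Vᵀ)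
          + noiseErr σ (R * Matrix.diagonal (fun i => Real.sqrt (lam i)) * Vᵀ)
        ≤ approxErr H S + noiseErr σ S := by
  have hD : D = diagonal fun i => D i i := hDdiag.diagonal_diag.symm
  have hHD : H = R * (diagonal fun i => D i i) * Rᵀ := by rw [← hD, hHRD]
  have hlam : ∀ i, 0 < lam i := fun i => (hlamFeas i).1
  have hDpos : 0 < ∑ i, D i i := by
    rw [hHRD, trace_mul_comm, ← Matrix.mul_assoc, hR, Matrix.one_mul] at htr
    exact htr
  refine ⟨?_, ?_, fun S hS hSh => ?_⟩
  · rw [det_mul, det_mul, det_diagonal, det_transpose]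
    refine (IsUnit.mul ?_ ?_).mul ?_
    · exact isUnit_det_of_left_inverse hR
    · exact (Finset.prod_pos fun i _ => Real.sqrt_pos.mpr (hlam i)).ne'.isUnit
    · exact isUnit_det_of_left_inverse hV
  · refine opNorm_mul_diagonal_mul_transpose_le hh.le hR hV fun i => ?_
    rw [Real.sq_sqrt (hlam i).le]
    exact (hlamFeas i).2
  · obtain ⟨ν, hν, hle⟩ := exists_gObj_le_approxErr_add_noiseErr hd (σ := σ) hh.le hR hDpos hS hSh
    rw [hHD, approxErr_add_noiseErr_eq_gObj σ hR hlam hk hV hVsq hVk]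
    exact (hlamMin ν hν).trans hle
end

section
/- Let D ∈ ℝ^{d×d} be diagonal with increasing diagonal entries and Σᵢ Dᵢ > 0, let σ, h > 0, and let K = #{i : Dᵢ ≤ 0}. For each J ∈ {K, …, d} with J < d, let λ_{A_J} denote the unique point satisfying the first-order stationarity formulas of the active-set function l_{A_J} (so λ_{A_J} has first J entries equal to h², and the remaining entries are determined by the unique positive solution a of the associated scalar equation), and let λ_{A_d} = h²·𝟙. Let J₀ be the smallest element of {K, …, d} such that λ_{A_{J₀}} is feasible, i.e., (λ_{A_{J₀}})ᵢ ≤ h² for all i. Then g(λ_{A_{J₀}}) = min_{λ ∈ Λ} g(λ), i.e., λ_{A_{J₀}} achieves the global minimum of the reduced objective. -/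
open Matrix

/-- The quantity `a = Σ_{i∉A} Dᵢλᵢ + h²·Σ_{i∈A} Dᵢ`. -/
noncomputable def aval {d : ℕ} (Dv : Fin d → ℝ) (h : ℝ)
    (A : Finset (Fin d)) (lam : Fin d → ℝ) : ℝ :=
  ∑ i ∈ Aᶜ, Dv i * lam i + h ^ 2 * ∑ i ∈ A, Dv i

/-- `statForm J lam` says that `lam` is positive, saturates the active set
`A_J = {1,…,J}` and satisfies the first-order stationarity formulas of `l_{A_J}`. -/
noncomputable def statForm {d : ℕ} [NeZero d] (Dv : Fin d → ℝ) (σ h : ℝ)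
    (J : ℕ) (lam : Fin d → ℝ) : Prop :=
  let A : Finset (Fin d) := Finset.univ.filter fun i => (i : ℕ) < J
  (∀ i, 0 < lam i) ∧ (∀ i ∈ A, lam i = h ^ 2) ∧
  0 < aval Dv h A lam ∧
  lam 0 = (if (0 : Fin d) ∈ A then h ^ 2 else
    (2 * d / (aval Dv h A lam * Dv 0)) *
      ((aval Dv h A lam) ^ 2 / (4 * d) + σ ^ 2 * (d + 1))) ∧
  ∀ i : Fin d, i ≠ 0 →
    lam i = (if i ∈ A then h ^ 2 else
      σ * Real.sqrt (2 * d * lam 0 / (aval Dv h A lam * Dv i)))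

/-- The function `l_∅`, obtained from `gObj` by replacing the maximal entry with the first one. -/
noncomputable def firstObj {d : ℕ} [NeZero d] (Dv : Fin d → ℝ) (σ : ℝ) (lam : Fin d → ℝ) : ℝ :=
  (∑ i, Dv i * lam i) ^ 2 / (4 * d * lam 0) + σ ^ 2 * ∑ i, 1 / lam i + σ ^ 2 * d / lam 0

/-- The `i`-th partial derivative of `firstObj`. -/
noncomputable def firstGrad {d : ℕ} [NeZero d] (Dv : Fin d → ℝ) (σ : ℝ) (lam : Fin d → ℝ)
    (i : Fin d) : ℝ :=
  (∑ j, Dv j * lam j) / (2 * d * lam 0) * Dv i - σ ^ 2 / lam i ^ 2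
    - if i = 0 then ((∑ j, Dv j * lam j) ^ 2 / (4 * d) + σ ^ 2 * d) / lam 0 ^ 2 else 0

/-- `IsCandidate J lam`: the first `J` entries of `lam` are saturated and `lam` is a critical point
of `firstObj` in the remaining coordinates. -/
structure IsCandidate {d : ℕ} [NeZero d] (Dv : Fin d → ℝ) (σ h : ℝ) (J : ℕ)
    (lam : Fin d → ℝ) : Prop where
  pos : ∀ i, 0 < lam i
  saturated : ∀ i : Fin d, (i : ℕ) < J → lam i = h ^ 2
  sum_pos : 0 < ∑ i, Dv i * lam i
  grad_eq_zero : ∀ i : Fin d, J ≤ (i : ℕ) → firstGrad Dv σ lam i = 0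

lemma inv_tangent_le {x y : ℝ} (hx : 0 < x) (hy : 0 < y) :
    1 / x - 1 / x ^ 2 * (y - x) ≤ 1 / y := by
  have : 1 / y - (1 / x - 1 / x ^ 2 * (y - x)) = (y - x) ^ 2 / (x ^ 2 * y) := by
    field_simp; ring
  have : 0 ≤ (y - x) ^ 2 / (x ^ 2 * y) := by positivity
  linarith

lemma sq_div_tangent_le {a b u v : ℝ} (hb : 0 < b) (hv : 0 < v) :
    a ^ 2 / b + 2 * a / b * (u - a) - a ^ 2 / b ^ 2 * (v - b) ≤ u ^ 2 / v := by
  have : u ^ 2 / v - (a ^ 2 / b + 2 * a / b * (u - a) - a ^ 2 / b ^ 2 * (v - b))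
      = (u * b - a * v) ^ 2 / (b ^ 2 * v) := by
    field_simp; ring
  have : 0 ≤ (u * b - a * v) ^ 2 / (b ^ 2 * v) := by positivity
  linarith

lemma firstObj_tangent_le {d : ℕ} [NeZero d] (Dv : Fin d → ℝ) (σ : ℝ) {lam mu : Fin d → ℝ}
    (hlam : ∀ i, 0 < lam i) (hmu : ∀ i, 0 < mu i) :
    firstObj Dv σ lam + ∑ i, firstGrad Dv σ lam i * (mu i - lam i) ≤ firstObj Dv σ mu := by
  have hd : (0 : ℝ) < d := Nat.cast_pos.mpr (NeZero.pos d)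
  have h0 := hlam 0
  set a := ∑ j, Dv j * lam j with ha
  set u := ∑ j, Dv j * mu j with hu
  have hgrad : ∑ i, firstGrad Dv σ lam i * (mu i - lam i) =
      a / (2 * d * lam 0) * (u - a) - σ ^ 2 * ∑ i, 1 / lam i ^ 2 * (mu i - lam i)
        - (a ^ 2 / (4 * d) + σ ^ 2 * d) / lam 0 ^ 2 * (mu 0 - lam 0) := by
    simp only [firstGrad, ← ha, sub_mul, Finset.sum_sub_distrib, ite_mul, zero_mul,
      Finset.sum_ite_eq', Finset.mem_univ, if_true]
    rw [hu]
    conv_rhs => rw [ha, ← Finset.sum_sub_distrib, ← ha, Finset.mul_sum, Finset.mul_sum]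
    rw [← Finset.sum_sub_distrib, ← Finset.sum_sub_distrib]
    congr 1
    exact Finset.sum_congr rfl fun i _ => by ring
  have h1 := sq_div_tangent_le (a := a) (u := u) h0 (hmu 0)
  have h2 := inv_tangent_le h0 (hmu 0)
  have h3 : ∑ i, 1 / lam i - ∑ i, 1 / lam i ^ 2 * (mu i - lam i) ≤ ∑ i, 1 / mu i := by
    rw [← Finset.sum_sub_distrib]
    exact Finset.sum_le_sum fun i _ => inv_tangent_le (hlam i) (hmu i)
  have h1' := mul_le_mul_of_nonneg_left h1 (by positivity : 0 ≤ 1 / (4 * (d : ℝ)))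
  have h2' := mul_le_mul_of_nonneg_left h2 (by positivity : 0 ≤ σ ^ 2 * (d : ℝ))
  have h3' := mul_le_mul_of_nonneg_left h3 (sq_nonneg σ)
  rw [hgrad]
  simp only [firstObj, ← ha, ← hu]
  have hmu0 := hmu 0
  have e1 : 1 / (4 * (d : ℝ)) * (u ^ 2 / mu 0) = u ^ 2 / (4 * d * mu 0) := by field_simp
  have e2 : 1 / (4 * (d : ℝ)) *
      (a ^ 2 / lam 0 + 2 * a / lam 0 * (u - a) - a ^ 2 / lam 0 ^ 2 * (mu 0 - lam 0)) =
      a ^ 2 / (4 * d * lam 0) + a / (2 * d * lam 0) * (u - a)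
        - a ^ 2 / (4 * d) / lam 0 ^ 2 * (mu 0 - lam 0) := by field_simp; ring
  have e3 : σ ^ 2 * d * (1 / lam 0 - 1 / lam 0 ^ 2 * (mu 0 - lam 0)) =
      σ ^ 2 * d / lam 0 - σ ^ 2 * d / lam 0 ^ 2 * (mu 0 - lam 0) := by ring
  have e4 : σ ^ 2 * d * (1 / mu 0) = σ ^ 2 * d / mu 0 := by ring
  rw [e1, e2] at h1'
  rw [e3, e4] at h2'
  rw [add_div, add_mul]
  linarith

lemma aval_eq_sum {d : ℕ} (Dv : Fin d → ℝ) (h : ℝ) (A : Finset (Fin d)) (lam : Fin d → ℝ)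
    (hA : ∀ i ∈ A, lam i = h ^ 2) : aval Dv h A lam = ∑ i, Dv i * lam i := by
  rw [aval, ← Finset.sum_compl_add_sum A, Finset.mul_sum]
  congr 1
  exact Finset.sum_congr rfl fun i hi => by rw [hA i hi, mul_comm]

lemma statForm.isCandidate {d : ℕ} [NeZero d] {Dv : Fin d → ℝ} {σ h : ℝ} {J : ℕ}
    {lam : Fin d → ℝ} (hs : statForm Dv σ h J lam) (hD : ∀ i : Fin d, J ≤ (i : ℕ) → 0 < Dv i) :
    IsCandidate Dv σ h J lam := by
  have hd : (0 : ℝ) < d := Nat.cast_pos.mpr (NeZero.pos d)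
  obtain ⟨hpos, hsat, ha, hzero, hrest⟩ := hs
  rw [aval_eq_sum Dv h _ lam hsat] at ha hzero hrest
  refine ⟨hpos, fun i hi => hsat i (by simpa using hi), ha, fun i hi => ?_⟩
  have hDi := hD i hi
  have hl0 := hpos 0
  have hli := hpos i
  have hiA : i ∉ Finset.univ.filter fun i : Fin d => (i : ℕ) < J := by simpa using hi
  simp only [firstGrad]
  set a := ∑ j, Dv j * lam j
  rcases eq_or_ne i 0 with rfl | hne
  · rw [if_neg hiA] at hzero
    have key : lam 0 * (a * Dv 0) = 2 * d * (a ^ 2 / (4 * d) + σ ^ 2 * (d + 1)) := by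
      conv_lhs => rw [hzero]
      field_simp
    have e : a ^ 2 / (4 * d) = lam 0 * (a * Dv 0) / (2 * d) - σ ^ 2 * (d + 1) := by
      rw [key]; field_simp; ring
    rw [if_pos rfl, e]
    field_simp
    ring
  · have hi2 := hrest i hne
    rw [if_neg hiA] at hi2
    have hsq : lam i ^ 2 = σ ^ 2 * (2 * d * lam 0 / (a * Dv i)) := by
      rw [hi2, mul_pow, Real.sq_sqrt (by positivity)]
    have hσ : σ ≠ 0 := by
      rintro rfl
      simp only [zero_mul] at hi2
      exact hli.ne' hi2
    rw [if_neg hne, hsq]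
    field_simp
    ring

lemma isCandidate_const {d : ℕ} [NeZero d] {Dv : Fin d → ℝ} (hsum : 0 < ∑ i, Dv i) (σ : ℝ)
    {h : ℝ} (hh : 0 < h) : IsCandidate Dv σ h d fun _ => h ^ 2 where
  pos _ := by positivity
  saturated _ _ := rfl
  sum_pos := by rw [← Finset.sum_mul]; positivity
  grad_eq_zero i hi := absurd i.isLt (by omega)

namespace IsCandidate

variable {d : ℕ} [NeZero d] {Dv : Fin d → ℝ} {σ h : ℝ} {J : ℕ} {lam nu : Fin d → ℝ}

lemma coeff_pos (hc : IsCandidate Dv σ h J lam) :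
    0 < (∑ j, Dv j * lam j) / (2 * d * lam 0) := by
  have hd : (0 : ℝ) < d := Nat.cast_pos.mpr (NeZero.pos d)
  have := hc.pos 0
  have := hc.sum_pos
  positivity

/-- In a candidate, the first unsaturated entry is the largest unsaturated one. -/
lemma entry_le (hc : IsCandidate Dv σ h J lam) (hmono : Monotone Dv) {k i : Fin d}
    (hk : (k : ℕ) = J) (hDk : 0 < Dv k) (hi : J ≤ (i : ℕ)) : lam i ≤ lam k := by
  rcases eq_or_ne i k with rfl | hne
  · exact le_rfl
  have hki : k ≤ i := Fin.le_def.mpr (hk ▸ hi)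
  have hi0 : i ≠ 0 := by
    rintro rfl
    exact hne (le_antisymm (Fin.zero_le k) hki)
  have gi := hc.grad_eq_zero i hi
  have gk := hc.grad_eq_zero k hk.ge
  have hcpos := hc.coeff_pos
  simp only [firstGrad] at gi gk
  rw [if_neg hi0] at gi
  set a := ∑ j, Dv j * lam j
  set c := a / (2 * d * lam 0)
  have hlk := hc.pos k
  have hli := hc.pos i
  have hpen : 0 ≤ if k = 0 then (a ^ 2 / (4 * d) + σ ^ 2 * d) / lam 0 ^ 2 else 0 := by
    split_ifs <;> positivity
  have h1 : σ ^ 2 = c * Dv i * lam i ^ 2 := by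
    have : σ ^ 2 / lam i ^ 2 = c * Dv i := by linarith
    rwa [div_eq_iff (by positivity)] at this
  have h2 : σ ^ 2 ≤ c * Dv k * lam k ^ 2 := by
    have : σ ^ 2 / lam k ^ 2 ≤ c * Dv k := by linarith
    rwa [div_le_iff₀ (by positivity)] at this
  have hDki := hmono hki
  have h3 : c * Dv k * lam k ^ 2 ≤ c * Dv i * lam k ^ 2 := by gcongr
  have hDi : 0 < c * Dv i := mul_pos hcpos (hDk.trans_le hDki)
  have h4 : lam i ^ 2 ≤ lam k ^ 2 := le_of_mul_le_mul_left (by linarith) hDi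
  exact (sq_le_sq₀ hli.le hlk.le).mp h4

/-- If the first unsaturated entry of a candidate exceeds the bound, then saturating it gives a
candidate whose derivative in that entry is nonpositive. -/
lemma grad_nonpos_of_lt (hc : IsCandidate Dv σ h J lam) (hn : IsCandidate Dv σ h (J + 1) nu)
    {k : Fin d} (hk : (k : ℕ) = J) (hlt : h ^ 2 < lam k) : firstGrad Dv σ nu k ≤ 0 := by
  have t1 := firstObj_tangent_le Dv σ hn.pos hc.pos
  have t2 := firstObj_tangent_le Dv σ hc.pos hn.pos
  have s2 : ∑ i, firstGrad Dv σ lam i * (nu i - lam i) = 0 := by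
    refine Finset.sum_eq_zero fun i _ => ?_
    rcases lt_or_ge (i : ℕ) J with hi | hi
    · rw [hc.saturated i hi, hn.saturated i (by omega), sub_self, mul_zero]
    · rw [hc.grad_eq_zero i hi, zero_mul]
  have s1 : ∑ i, firstGrad Dv σ nu i * (lam i - nu i) =
      firstGrad Dv σ nu k * (lam k - h ^ 2) := by
    rw [← hn.saturated k (by omega)]
    refine Fintype.sum_eq_single k fun i hik => ?_
    have hne : (i : ℕ) ≠ k := fun e => hik (Fin.ext e)
    rcases lt_or_ge (i : ℕ) J with hi | hi
    · rw [hc.saturated i hi, hn.saturated i (by omega), sub_self, mul_zero]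
    · rw [hn.grad_eq_zero i (by omega), zero_mul]
  rw [s1] at t1
  rw [s2] at t2
  by_contra! hpos
  have := mul_pos hpos (sub_pos.mpr hlt)
  linarith

lemma grad_nonpos_of_nonpos (hc : IsCandidate Dv σ h J lam) {i : Fin d} (hD : Dv i ≤ 0) :
    firstGrad Dv σ lam i ≤ 0 := by
  have h1 := mul_nonpos_of_nonneg_of_nonpos hc.coeff_pos.le hD
  have hli := hc.pos i
  have h2 : 0 ≤ σ ^ 2 / lam i ^ 2 := by positivity
  simp only [firstGrad]
  have hpen : 0 ≤ if i = 0 then ((∑ j, Dv j * lam j) ^ 2 / (4 * d) + σ ^ 2 * d) / lam 0 ^ 2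
      else 0 := by
    split_ifs <;> positivity
  linarith

/-- Nonpositivity of the derivative propagates to smaller indices among the saturated entries. -/
lemma grad_nonpos_of_le (hc : IsCandidate Dv σ h J lam) (hmono : Monotone Dv) {i k : Fin d}
    (hik : i ≤ k) (hk : (k : ℕ) < J) (hg : firstGrad Dv σ lam k ≤ 0) :
    firstGrad Dv σ lam i ≤ 0 := by
  rcases eq_or_ne i k with rfl | hne
  · exact hg
  have hk0 : k ≠ 0 := by
    rintro rfl
    exact hne (le_antisymm hik (Fin.zero_le i))
  have hD := mul_le_mul_of_nonneg_left (hmono hik) hc.coeff_pos.le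
  simp only [firstGrad] at hg ⊢
  rw [if_neg hk0, hc.saturated k hk] at hg
  rw [hc.saturated i (lt_of_le_of_lt hik hk)]
  have hpen : 0 ≤ if i = 0 then ((∑ j, Dv j * lam j) ^ 2 / (4 * d) + σ ^ 2 * d) / lam 0 ^ 2
      else 0 := by
    split_ifs <;> positivity
  linarith

lemma firstObj_le (hc : IsCandidate Dv σ h J lam)
    (hg : ∀ i : Fin d, (i : ℕ) < J → firstGrad Dv σ lam i ≤ 0)
    {mu : Fin d → ℝ} (hmu : ∀ i, 0 < mu i ∧ mu i ≤ h ^ 2) :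
    firstObj Dv σ lam ≤ firstObj Dv σ mu := by
  have t := firstObj_tangent_le Dv σ hc.pos fun i => (hmu i).1
  have : 0 ≤ ∑ i, firstGrad Dv σ lam i * (mu i - lam i) := by
    refine Finset.sum_nonneg fun i _ => ?_
    rcases lt_or_ge (i : ℕ) J with hi | hi
    · refine mul_nonneg_of_nonpos_of_nonpos (hg i hi) ?_
      rw [hc.saturated i hi]
      linarith [(hmu i).2]
    · rw [hc.grad_eq_zero i hi, zero_mul]
  linarith

end IsCandidate

lemma gObj_le_firstObj {d : ℕ} [NeZero d] (Dv : Fin d → ℝ) (σ : ℝ) {lam : Fin d → ℝ}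
    (hlam : ∀ i, 0 < lam i) : gObj Dv σ lam ≤ firstObj Dv σ lam := by
  have hd : (0 : ℝ) < d := Nat.cast_pos.mpr (NeZero.pos d)
  have h0 := hlam 0
  have hle : lam 0 ≤ ⨆ i, lam i := le_ciSup (Set.finite_range lam).bddAbove 0
  unfold gObj firstObj
  gcongr

/-- Exchanging the largest entry of `mu` with the first one does not increase `∑ i, Dv i * mu i`. -/
lemma sum_mul_swap_le {d : ℕ} [NeZero d] {Dv : Fin d → ℝ} (hmono : Monotone Dv)
    {mu : Fin d → ℝ} {k : Fin d} (hk : ∀ i, mu i ≤ mu k) :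
    ∑ i, Dv i * mu (Equiv.swap 0 k i) ≤ ∑ i, Dv i * mu i := by
  rcases eq_or_ne (0 : Fin d) k with h0 | hne
  · simp [← h0]
  have hdiff : ∑ i, (Dv i * mu i - Dv i * mu (Equiv.swap 0 k i)) =
      (Dv k - Dv 0) * (mu k - mu 0) := by
    rw [Fintype.sum_eq_add 0 k hne fun i hi => by
      rw [Equiv.swap_apply_of_ne_of_ne hi.1 hi.2, sub_self]]
    rw [Equiv.swap_apply_left, Equiv.swap_apply_right]
    ring
  have := mul_nonneg (sub_nonneg.mpr (hmono (Fin.zero_le k))) (sub_nonneg.mpr (hk 0))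
  rw [Finset.sum_sub_distrib] at hdiff
  linarith

/-- A feasible point with `∑ i, Dv i * mu i < 0` can be increased within the feasible set until
that sum vanishes. -/
lemma exists_ge_sum_mul_eq_zero {d : ℕ} {Dv : Fin d → ℝ} (hsum : 0 < ∑ i, Dv i)
    {b : ℝ} (hb : 0 < b) {mu : Fin d → ℝ} (hmu : ∀ i, mu i ≤ b)
    (hneg : ∑ i, Dv i * mu i < 0) :
    ∃ nu : Fin d → ℝ, (∀ i, mu i ≤ nu i ∧ nu i ≤ b) ∧ ∑ i, Dv i * nu i = 0 := by
  set a := ∑ i, Dv i * mu i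
  have hS : 0 < b * ∑ i, Dv i := by positivity
  set s := b * ∑ i, Dv i
  have hden : 0 < s - a := by linarith
  have ht0 : 0 ≤ -a / (s - a) := div_nonneg (by linarith) hden.le
  have ht1 : -a / (s - a) ≤ 1 := (div_le_one hden).mpr (by linarith)
  refine ⟨fun i => mu i + -a / (s - a) * (b - mu i), fun i => ⟨?_, ?_⟩, ?_⟩
  · have := mul_nonneg ht0 (sub_nonneg.mpr (hmu i))
    linarith
  · have := mul_le_mul_of_nonneg_right ht1 (sub_nonneg.mpr (hmu i))
    linarith
  · have : ∑ i, Dv i * (mu i + -a / (s - a) * (b - mu i)) = a + -a / (s - a) * (s - a) := by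
      simp only [s, a, Finset.mul_sum, ← Finset.sum_sub_distrib, ← Finset.sum_add_distrib]
      exact Finset.sum_congr rfl fun i _ => by ring
    rw [this, div_mul_cancel₀ _ hden.ne', add_neg_cancel]

lemma exists_firstObj_le_gObj {d : ℕ} [NeZero d] {Dv : Fin d → ℝ} (hmono : Monotone Dv)
    (hsum : 0 < ∑ i, Dv i) (σ : ℝ) {b : ℝ} (hb : 0 < b) {mu : Fin d → ℝ}
    (hmu : ∀ i, 0 < mu i ∧ mu i ≤ b) :
    ∃ nu : Fin d → ℝ, (∀ i, 0 < nu i ∧ nu i ≤ b) ∧ firstObj Dv σ nu ≤ gObj Dv σ mu := by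
  have hd : (0 : ℝ) < d := Nat.cast_pos.mpr (NeZero.pos d)
  obtain ⟨k, hk⟩ := Finite.exists_max mu
  have hsup : ⨆ i, mu i = mu k :=
    le_antisymm (ciSup_le hk) (le_ciSup (Set.finite_range mu).bddAbove k)
  have hswap := sum_mul_swap_le hmono hk
  set w : Fin d → ℝ := fun i => mu (Equiv.swap 0 k i)
  have hw0 : w 0 = mu k := by simp only [w, Equiv.swap_apply_left]
  have hinv : ∑ i, 1 / w i = ∑ i, 1 / mu i := Equiv.sum_comp (Equiv.swap 0 k) fun i => 1 / mu i
  have hw : ∀ i, 0 < w i ∧ w i ≤ b := fun i => hmu _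
  have hmuk := (hmu k).1
  unfold firstObj gObj
  rw [hsup, ← hinv]
  rcases le_or_gt 0 (∑ i, Dv i * w i) with hnn | hneg
  · refine ⟨w, hw, ?_⟩
    rw [hw0]
    gcongr
  · obtain ⟨nu, hnu, hzero⟩ := exists_ge_sum_mul_eq_zero hsum hb (fun i => (hw i).2) hneg
    refine ⟨nu, fun i => ⟨(hw i).1.trans_le (hnu i).1, (hnu i).2⟩, ?_⟩
    have h0 : mu k ≤ nu 0 := hw0 ▸ (hnu 0).1
    have hs : ∑ i, 1 / nu i ≤ ∑ i, 1 / w i :=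
      Finset.sum_le_sum fun i _ => one_div_le_one_div_of_le (hw i).1 (hnu i).1
    have hnn : 0 ≤ (∑ i, Dv i * mu i) ^ 2 / (4 * d * mu k) := by positivity
    rw [hzero, zero_pow two_ne_zero, zero_div]
    gcongr

lemma nonpos_iff_lt_card {d : ℕ} {Dv : Fin d → ℝ} (hmono : Monotone Dv) (i : Fin d) :
    Dv i ≤ 0 ↔ (i : ℕ) < (Finset.univ.filter fun j => Dv j ≤ 0).card := by
  constructor
  · intro hi
    have : Finset.Iic i ⊆ Finset.univ.filter fun j => Dv j ≤ 0 := fun j hj => by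
      simpa using (hmono (Finset.mem_Iic.mp hj)).trans hi
    have := Finset.card_le_card this
    rw [Fin.card_Iic] at this
    omega
  · contrapose!
    intro hi
    have : (Finset.univ.filter fun j => Dv j ≤ 0) ⊆ Finset.Iio i := fun j hj => by
      rw [Finset.mem_Iio]
      by_contra! hij
      exact absurd (hmono hij) (not_le.mpr ((Finset.mem_filter.mp hj).2.trans_lt hi))
    simpa using Finset.card_le_card this

/-- The first feasible active-set candidate is the global minimizer of
the reduced objective. -/
theorem first_feasible_candidate_is_global_min
    (d : ℕ) [NeZero d] (Dv : Fin d → ℝ) (hmono : Monotone Dv)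
    (hsum : 0 < ∑ i, Dv i) (σ h : ℝ) (hσ : 0 < σ) (hh : 0 < h)
    (K : ℕ) (hK : K = (Finset.univ.filter fun i => Dv i ≤ 0).card)
    (lamJ : ℕ → Fin d → ℝ)
    (hstat : ∀ J, K ≤ J → J < d → statForm Dv σ h J (lamJ J))
    (hlamd : lamJ d = fun _ => h ^ 2)
    (J₀ : ℕ) (hJ₀K : K ≤ J₀) (hJ₀d : J₀ ≤ d)
    (hfeas : ∀ i, lamJ J₀ i ≤ h ^ 2)
    (hJ₀min : ∀ J, K ≤ J → J < J₀ → ¬ (∀ i, lamJ J i ≤ h ^ 2)) :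
    (∀ i, 0 < lamJ J₀ i ∧ lamJ J₀ i ≤ h ^ 2) ∧
    ∀ mu : Fin d → ℝ, (∀ i, 0 < mu i ∧ mu i ≤ h ^ 2) →
      gObj Dv σ (lamJ J₀) ≤ gObj Dv σ mu := by
  have hDpos : ∀ J, K ≤ J → ∀ i : Fin d, J ≤ (i : ℕ) → 0 < Dv i := fun J hJ i hi => by
    by_contra! hle
    have := (nonpos_iff_lt_card hmono i).mp hle
    omega
  have hcand : ∀ J, K ≤ J → J ≤ d → IsCandidate Dv σ h J (lamJ J) := fun J hKJ hJd => by
    rcases hJd.eq_or_lt with rfl | hlt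
    · rw [hlamd]
      exact isCandidate_const hsum σ hh
    · exact (hstat J hKJ hlt).isCandidate (hDpos J hKJ)
  have hc := hcand J₀ hJ₀K hJ₀d
  have hgrad : ∀ i : Fin d, (i : ℕ) < J₀ → firstGrad Dv σ (lamJ J₀) i ≤ 0 := fun i hi => by
    rcases hJ₀K.eq_or_lt with heq | hlt
    · refine hc.grad_nonpos_of_nonpos ((nonpos_iff_lt_card hmono i).mpr ?_)
      omega
    · obtain ⟨J, rfl⟩ : ∃ J, J₀ = J + 1 := ⟨J₀ - 1, by omega⟩
      have hKJ : K ≤ J := by omega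
      have hprev := hcand J hKJ (by omega)
      let k : Fin d := ⟨J, by omega⟩
      have hlarge : h ^ 2 < lamJ J k := by
        by_contra! hle
        refine hJ₀min J hKJ (by omega) fun j => ?_
        rcases lt_or_ge (j : ℕ) J with hj | hj
        · exact (hprev.saturated j hj).le
        · exact (hprev.entry_le hmono rfl (hDpos J hKJ k le_rfl) hj).trans hle
      have hik : i ≤ k := Fin.le_def.mpr (Nat.le_of_lt_succ hi)
      exact hc.grad_nonpos_of_le hmono hik (Nat.lt_succ_self J)
        (hprev.grad_nonpos_of_lt hc rfl hlarge)
  refine ⟨fun i => ⟨hc.pos i, hfeas i⟩, fun mu hmu => ?_⟩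
  obtain ⟨nu, hnu, hle⟩ := exists_firstObj_le_gObj hmono hsum σ (pow_pos hh 2) hmu
  exact (gObj_le_firstObj Dv σ hc.pos).trans ((hc.firstObj_le hgrad hnu).trans hle)
end
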